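/- arXiv:1904.08402 — 2 statements merged into one kernel-verified Lean document; each statement's English description precedes it below -/
import Mathlib

section
/- There exist constants a, b > 0 such that for all n ≥ 1, width(Z(n)) ≤ a · 2^{b·√(log₂ n)}. -/
/-- A Dyck word: entries ±1, total sum zero, all prefix sums nonnegative. -/
def IsDyck (w : List ℤ) : Prop :=
  (∀ a ∈ w, a = 1 ∨ a = -1) ∧ w.sum = 0 ∧ ∀ k, 0 ≤ (w.take k).sum

/-- Width of a finite set of naturals: the least number of intervals of
consecutive integers whose union equals the set. -/
noncomputable def setWidth (S : Finset ℕ) : ℕ :=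
  sInf {k | ∃ f : Fin k → ℕ × ℕ, (S : Set ℕ) = ⋃ i, Set.Icc (f i).1 (f i).2}

/-- A re-pairing of a word `w` over `{+1, -1}` (positions are 0-based):
a sequence of pairs (ℓᵢ, rᵢ) with w(ℓᵢ) = +1, w(rᵢ) = −1, ℓᵢ < rᵢ, such that
every position of `w` occurs in exactly one pair. -/
structure RePairing (w : List ℤ) where
  pairs : List (ℕ × ℕ)
  perm : (pairs.flatMap fun q => [q.1, q.2]).Perm (List.range w.length)
  lt : ∀ q ∈ pairs, q.1 < q.2
  plus : ∀ q ∈ pairs, w.getD q.1 0 = 1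
  minus : ∀ q ∈ pairs, w.getD q.2 0 = -1

/-- The width of a re-pairing: maximum over times `t` of the width of the set
of positions erased within the first `t` pairs. -/
noncomputable def repWidth {w : List ℤ} (p : RePairing w) : ℕ :=
  (Finset.range (p.pairs.length + 1)).sup
    fun t => setWidth ((p.pairs.take t).flatMap fun q => [q.1, q.2]).toFinset

/-- Width of a word: minimum width over all its re-pairings. -/
noncomputable def dyckWidth (w : List ℤ) : ℕ :=
  sInf {k | ∃ p : RePairing w, repWidth p = k}

/-- Z(1) = +−, Z(n+1) = + Z(n) Z(n) −. -/
def Zword : ℕ → List ℤ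
  | 0 => []
  | n + 1 => 1 :: (Zword n ++ Zword n ++ [-1])

/-- The number of maximal blocks of zeros in a word; a zero marks an erased position. -/
def zeroRuns : List ℤ → ℕ
  | [] => 0
  | x :: xs => zeroRuns xs + if x = 0 ∧ xs.head? ≠ some 0 then 1 else 0

lemma zeroRuns_append (u v : List ℤ) : zeroRuns (u ++ v) ≤ zeroRuns u + zeroRuns v := by
  induction u with
  | nil => simp [zeroRuns]
  | cons x xs ih =>
    cases xs with
    | nil => simp only [List.nil_append, List.cons_append, zeroRuns]; split_ifs <;> simp_all
    | cons y ys =>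
      rw [List.cons_append, zeroRuns, zeroRuns, List.cons_append, List.head?_cons, List.head?_cons,
        ← List.cons_append]
      omega

lemma zeroRuns_eq_zero {u : List ℤ} (h : 0 ∉ u) : zeroRuns u = 0 := by
  induction u with
  | nil => rfl
  | cons x xs ih =>
    simp only [List.mem_cons, not_or] at h
    simp [zeroRuns, ih h.2, Ne.symm h.1]

lemma zeroRuns_replicate_zero (p : ℕ) : zeroRuns (List.replicate p 0) ≤ 1 := by
  induction p with
  | zero => simp [zeroRuns]
  | succ p ih => cases p <;> simp_all [List.replicate_succ, zeroRuns]

lemma zeroRuns_zero_cons_zero_cons (v : List ℤ) :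
    zeroRuns (0 :: 0 :: v) = zeroRuns (0 :: v) := by
  simp [zeroRuns]

/-- `Erases B u v`: one can get from `u` to `v` by erasing pairs `+1 … -1`
while never having more than `B` blocks of erased positions. -/
inductive Erases (B : ℕ) : List ℤ → List ℤ → Prop
  | refl (u : List ℤ) : zeroRuns u ≤ B → Erases B u u
  | step (a b c w : List ℤ) : zeroRuns (a ++ 1 :: (b ++ -1 :: c)) ≤ B →
      Erases B (a ++ 0 :: (b ++ 0 :: c)) w → Erases B (a ++ 1 :: (b ++ -1 :: c)) w

lemma Erases.trans {B : ℕ} {u v w : List ℤ} (h : Erases B u v) (h' : Erases B v w) :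
    Erases B u w := by
  induction h with
  | refl => exact h'
  | step a b c _ hr _ ih => exact .step a b c _ hr (ih h')

lemma Erases.context {W B : ℕ} {u v : List ℤ} (h : Erases W u v) (x y : List ℤ)
    (hB : zeroRuns x + W + zeroRuns y ≤ B) : Erases B (x ++ u ++ y) (x ++ v ++ y) := by
  have bound : ∀ z, zeroRuns z ≤ W → zeroRuns (x ++ z ++ y) ≤ B := fun z hz => by
    have h₁ := zeroRuns_append (x ++ z) y
    have h₂ := zeroRuns_append x z
    omega
  induction h with
  | refl u hr => exact .refl _ (bound u hr)
  | step a b c w hr _ ih =>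
    have := bound _ hr
    simp only [List.append_assoc, List.cons_append] at this ih ⊢
    simpa using Erases.step (x ++ a) b (c ++ y) _ (by simpa using this) (by simpa using ih)

/-- `Strips K t v w`: one can get from `v` to `w` by erasing `t` entries `-1` one at a time
while never having more than `K` blocks of erased positions. -/
inductive Strips (K : ℕ) : ℕ → List ℤ → List ℤ → Prop
  | refl (v : List ℤ) : zeroRuns v ≤ K → Strips K 0 v v
  | step (t : ℕ) (a b w : List ℤ) : zeroRuns (a ++ -1 :: b) ≤ K →
      Strips K t (a ++ 0 :: b) w → Strips K (t + 1) (a ++ -1 :: b) w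

lemma Strips.zeroRuns_le {K t : ℕ} {v w : List ℤ} (h : Strips K t v w) : zeroRuns v ≤ K := by
  cases h <;> assumption

lemma Strips.cons_neg_one {K t : ℕ} {v w : List ℤ} (h : Strips K t v w)
    (hw : zeroRuns (0 :: w) ≤ K) : Strips K (t + 1) (-1 :: v) (0 :: w) := by
  induction h with
  | refl v hr => exact .step 0 [] v _ (by simpa [zeroRuns] using hr) (.refl _ hw)
  | step t a b w hr _ ih =>
    exact .step (t + 1) (-1 :: a) b _ (by simpa [zeroRuns] using hr) (ih hw)

/-- The word `Zword m` without its last `c` letters (for `c ≤ m`), which are all `-1`. -/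
def ZwordTrunc : ℕ → ℕ → List ℤ
  | m, 0 => Zword m
  | 0, _ + 1 => []
  | m + 1, c + 1 => 1 :: (Zword m ++ ZwordTrunc m c)

lemma zero_notMem_Zword (m : ℕ) : 0 ∉ Zword m := by
  induction m with
  | zero => simp [Zword]
  | succ m ih => simp [Zword, ih]

lemma zero_notMem_ZwordTrunc (m c : ℕ) : 0 ∉ ZwordTrunc m c := by
  induction c generalizing m with
  | zero => cases m <;> simpa [ZwordTrunc] using zero_notMem_Zword _
  | succ c ih => cases m <;> simp [ZwordTrunc, zero_notMem_Zword, ih]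

lemma ZwordTrunc_zero (m : ℕ) : ZwordTrunc m 0 = Zword m := by cases m <;> rfl

lemma ZwordTrunc_eq_append {m c : ℕ} (h : c < m) :
    ZwordTrunc m c = ZwordTrunc m (c + 1) ++ [-1] := by
  induction c generalizing m with
  | zero => obtain ⟨m, rfl⟩ : ∃ k, m = k + 1 := ⟨m - 1, by omega⟩
            simp [ZwordTrunc, ZwordTrunc_zero, Zword]
  | succ c ih =>
    obtain ⟨m, rfl⟩ : ∃ k, m = k + 1 := ⟨m - 1, by omega⟩
    simp [ZwordTrunc, ← ih (show c < m by omega)]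

/-- The part of `Zword (d + m)` to the right of its leftmost factor `Zword m`. -/
def ZwordTail (m : ℕ) : ℕ → List ℤ
  | 0 => []
  | d + 1 => ZwordTail m d ++ (Zword (d + m) ++ [-1])

lemma zero_notMem_ZwordTail (m d : ℕ) : 0 ∉ ZwordTail m d := by
  induction d with
  | zero => simp [ZwordTail]
  | succ d ih => simp [ZwordTail, ih, zero_notMem_Zword]

lemma Zword_add (m d : ℕ) :
    Zword (d + m) = List.replicate d 1 ++ (Zword m ++ ZwordTail m d) := by
  induction d with
  | zero => simp [ZwordTail]
  | succ d ih =>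
    rw [show d + 1 + m = (d + m) + 1 by omega, Zword]
    conv_lhs => enter [2, 1, 1]; rw [ih]
    simp [ZwordTail, List.replicate_succ]

lemma zeroRuns_replicate_append_le (p e : ℕ) {w v : List ℤ} (hw : 0 ∉ w) :
    zeroRuns (List.replicate p 0 ++ (w ++ (List.replicate e 0 ++ v))) ≤ zeroRuns v + 2 := by
  have h₁ := zeroRuns_append (List.replicate p 0) (w ++ (List.replicate e 0 ++ v))
  have h₂ := zeroRuns_append w (List.replicate e 0 ++ v)
  have h₃ := zeroRuns_append (List.replicate e 0) v
  have h₄ := zeroRuns_replicate_zero p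
  have h₅ := zeroRuns_replicate_zero e
  have h₆ := zeroRuns_eq_zero hw
  omega

lemma erases_ZwordTrunc {W K e m c : ℕ} {v v' : List ℤ}
    (hZ : ∀ i ≤ m, ∃ q, Erases W (Zword i) (List.replicate q 0))
    (p : ℕ) (hc : c ≤ m) (hv : Strips K c v v') :
    ∃ q, Erases (W + K + 2)
      (List.replicate p 0 ++ (ZwordTrunc m c ++ (List.replicate e 0 ++ v)))
      (List.replicate q 0 ++ v') := by
  induction c generalizing p m v with
  | zero =>
    cases hv with
    | refl _ hr =>
      obtain ⟨q, hq⟩ := hZ m le_rfl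
      refine ⟨p + q + e, ?_⟩
      have h₁ := zeroRuns_append (List.replicate e 0) v'
      have h₂ := zeroRuns_replicate_zero e
      have h₃ := zeroRuns_replicate_zero p
      have := hq.context (B := W + K + 2) (List.replicate p 0) (List.replicate e 0 ++ v') (by omega)
      simpa only [ZwordTrunc_zero, List.replicate_add, List.append_assoc] using this
  | succ c ih =>
    obtain ⟨m, rfl⟩ : ∃ k, m = k + 1 := ⟨m - 1, by omega⟩
    cases hv with
    | step _ a b _ hr hs =>
      obtain ⟨r, hr'⟩ := hZ m (by omega)
      obtain ⟨q, hq⟩ := ih (m := m) (fun i hi => hZ i (by omega)) (p + 1 + r) (by omega) hs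
      refine ⟨q, ?_⟩
      have hk := zeroRuns_replicate_append_le p e (v := a ++ -1 :: b) (zero_notMem_ZwordTrunc (m + 1) (c + 1))
      have hctx := hr'.context (B := W + K + 2) (List.replicate (p + 1) 0)
        (ZwordTrunc m c ++ (List.replicate e 0 ++ (a ++ 0 :: b))) (by
          have h₁ := zeroRuns_replicate_append_le 0 e (v := a ++ 0 :: b) (zero_notMem_ZwordTrunc m c)
          have h₂ := zeroRuns_replicate_zero (p + 1)
          have h₃ := hs.zeroRuns_le
          have h₄ := zeroRuns_append (ZwordTrunc m c) (List.replicate e 0 ++ (a ++ 0 :: b))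
          have h₅ := zeroRuns_append (List.replicate e 0) (a ++ 0 :: b)
          have h₆ := zeroRuns_replicate_zero e
          have h₇ := zeroRuns_eq_zero (zero_notMem_ZwordTrunc m c)
          omega)
      have := Erases.step (B := W + K + 2) (List.replicate p 0)
        (Zword m ++ (ZwordTrunc m c ++ (List.replicate e 0 ++ a))) b
        (List.replicate q 0 ++ v')
        (by simp only [ZwordTrunc, List.append_assoc, List.cons_append] at hk ⊢; omega)
        (by
          have := hctx.trans (by simpa [List.replicate_add] using hq)
          simpa [List.replicate_add] using this)
      simpa [ZwordTrunc] using this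

lemma erases_ones_ZwordTrunc {W K e m c j : ℕ} {v v' : List ℤ}
    (hZ : ∀ i ≤ m, ∃ q, Erases W (Zword i) (List.replicate q 0))
    (p : ℕ) (hc : c ≤ m) (hv : Strips K (j + c) v v') :
    ∃ q, Erases (W + K + 2)
      (List.replicate p 0 ++
        (List.replicate j 1 ++ (ZwordTrunc m c ++ (List.replicate e 0 ++ v))))
      (List.replicate q 0 ++ v') := by
  induction j generalizing p v with
  | zero => simpa using erases_ZwordTrunc hZ p hc (by simpa using hv)
  | succ j ih =>
    rw [show j + 1 + c = j + c + 1 by omega] at hv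
    cases hv with
    | step _ a b _ hr hs =>
      obtain ⟨q, hq⟩ := ih (p + 1) hs
      refine ⟨q, ?_⟩
      have hk := zeroRuns_replicate_append_le p e (w := List.replicate (j + 1) 1 ++ ZwordTrunc m c)
        (v := a ++ -1 :: b) (by simp [zero_notMem_ZwordTrunc])
      have := Erases.step (B := W + K + 2) (List.replicate p 0)
        (List.replicate j 1 ++ (ZwordTrunc m c ++ (List.replicate e 0 ++ a))) b
        (List.replicate q 0 ++ v')
        (by simp only [List.replicate_succ, List.append_assoc, List.cons_append] at hk ⊢; omega)
        (by simpa [List.replicate_add] using hq)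
      simpa [List.replicate_succ] using this

lemma strips_ZwordTrunc {m d c t : ℕ} {v : List ℤ} (h : c + t ≤ m) (hv : 0 ∉ v) :
    Strips 2 t
      (List.replicate d 1 ++ (ZwordTrunc m c ++ (List.replicate c 0 ++ v)))
      (List.replicate d 1 ++ (ZwordTrunc m (c + t) ++ (List.replicate (c + t) 0 ++ v))) := by
  have bound : ∀ c, zeroRuns
      (List.replicate d 1 ++ (ZwordTrunc m c ++ (List.replicate c 0 ++ v))) ≤ 2 := fun c => by
    have := zeroRuns_replicate_append_le 0 c (w := List.replicate d 1 ++ ZwordTrunc m c) (v := v)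
      (by simp [zero_notMem_ZwordTrunc])
    simpa [zeroRuns_eq_zero hv] using this
  induction t generalizing c with
  | zero => exact .refl _ (bound c)
  | succ t ih =>
    have hb := bound c
    have hs := ih (c := c + 1) (by omega)
    rw [ZwordTrunc_eq_append (show c < m by omega)] at hb ⊢
    rw [show c + 1 + t = c + (t + 1) by omega] at hs
    have := Strips.step t (List.replicate d 1 ++ ZwordTrunc m (c + 1))
      (List.replicate c 0 ++ v) _ (by simpa using hb) (by simpa [List.replicate_succ] using hs)
    simpa only [List.append_assoc, List.cons_append, List.nil_append] using this

lemma erases_truncated_subtree {W m : ℕ}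
    (hZ : ∀ i ≤ m, ∃ q, Erases W (Zword i) (List.replicate q 0))
    (d p j c : ℕ) {v v' : List ℤ} (hd : j + c + d ≤ m) (hv₀ : 0 ∉ v)
    (hv : Strips 2 (j + c) v v') (hv' : zeroRuns (0 :: v') ≤ 2) :
    ∃ q, Erases (W + 4)
      (List.replicate p 0 ++ (List.replicate (j + d) 1 ++
        (ZwordTrunc m c ++ (List.replicate c 0 ++ (ZwordTail m d ++ v)))))
      (List.replicate q 0 ++ v') := by
  induction d generalizing p j c v v' with
  | zero => simpa [ZwordTail] using erases_ones_ZwordTrunc (c := c) (e := c) hZ p (by omega) hv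
  | succ d ih =>
    have hv₁ : 0 ∉ ZwordTail m d ++ -1 :: v := by simp [zero_notMem_ZwordTail, hv₀]
    obtain ⟨q, hq⟩ := ih p (j + 1) c (v := Zword (d + m) ++ -1 :: v)
      (v' := List.replicate d 1 ++ (ZwordTrunc m (j + 1 + c) ++
        (List.replicate (j + 1 + c) 0 ++ (ZwordTail m d ++ -1 :: v))))
      (by omega) (by simp [zero_notMem_Zword, hv₀])
      (by
        have := strips_ZwordTrunc (m := m) (d := d) (c := 0) (t := j + 1 + c) (by omega) hv₁
        simpa [Zword_add, ZwordTrunc_zero] using this)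
      (by
        have := zeroRuns_replicate_append_le 1 (j + 1 + c)
          (w := List.replicate d 1 ++ ZwordTrunc m (j + 1 + c)) (v := ZwordTail m d ++ -1 :: v)
          (by simp [zero_notMem_ZwordTrunc])
        simpa [zeroRuns_eq_zero hv₁] using this)
    obtain ⟨r, hr⟩ := ih q 0 (j + 1 + c) (v := -1 :: v) (v' := 0 :: v') (by omega)
      (by simp [hv₀])
      (by
        rw [show 0 + (j + 1 + c) = j + c + 1 by omega]
        exact hv.cons_neg_one hv')
      (by rwa [zeroRuns_zero_cons_zero_cons])
    refine ⟨r + 1, ?_⟩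
    rw [show j + 1 + d = j + (d + 1) by omega] at hq
    have := Erases.trans hq (by simpa using hr)
    simpa [ZwordTail, List.replicate_add] using this

lemma erases_Zword_add {W m d : ℕ} (hd : d ≤ m)
    (hZ : ∀ i ≤ m, ∃ q, Erases W (Zword i) (List.replicate q 0)) :
    ∃ q, Erases (W + 4) (Zword (d + m)) (List.replicate q 0) := by
  have := erases_truncated_subtree hZ d 0 0 0 (v := []) (v' := []) (by omega) (by simp)
    (.refl _ (by simp [zeroRuns])) (by simp [zeroRuns])
  simpa [Zword_add, ZwordTrunc_zero] using this

lemma erases_Zword_of_le_two_pow {s i : ℕ} (hi : i ≤ 2 ^ s) :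
    ∃ q, Erases (4 * s + 1) (Zword i) (List.replicate q 0) := by
  induction s generalizing i with
  | zero =>
    have : i = 0 ∨ i = 1 := by simp at hi; omega
    rcases this with rfl | rfl
    · exact ⟨0, .refl _ (by simp [Zword, zeroRuns])⟩
    · exact ⟨2, .step [] [] [] _ (by simp [zeroRuns]) (.refl _ (by simp [zeroRuns]))⟩
  | succ s ih =>
    by_cases h : i ≤ 2 ^ s
    · obtain ⟨q, hq⟩ := ih h
      exact ⟨q, by simpa using hq.context (B := 4 * (s + 1) + 1) [] [] (by simp [zeroRuns])⟩
    · obtain ⟨d, rfl⟩ : ∃ d, i = d + 2 ^ s := ⟨i - 2 ^ s, by omega⟩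
      exact erases_Zword_add (by rw [pow_succ] at hi; omega) fun i hi => ih hi

lemma exists_intervals (u : List ℤ) : ∃ l : List (ℕ × ℕ), l.length = zeroRuns u ∧
    ∀ i, u[i]? = some 0 ↔ ∃ q ∈ l, q.1 ≤ i ∧ i ≤ q.2 := by
  induction u with
  | nil => exact ⟨[], rfl, by simp⟩
  | cons x xs ih =>
    obtain ⟨l, hl, h⟩ := ih
    have shift : ∀ i, xs[i]? = some 0 ↔
        ∃ q ∈ l.map (fun q => (q.1 + 1, q.2 + 1)), q.1 ≤ i + 1 ∧ i + 1 ≤ q.2 := by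
      intro i; simp [h i]
    by_cases hx : x = 0
    · by_cases hxs : xs.head? = some 0
      · refine ⟨l.map fun q => (if q.1 = 0 then 0 else q.1 + 1, q.2 + 1),
          by simp [zeroRuns, hl, hxs], fun i => ?_⟩
        cases i with
        | zero =>
          have h₀ := h 0
          rw [← List.head?_eq_getElem?] at h₀
          obtain ⟨q, hq, hq₀, -⟩ := h₀.1 hxs
          simp only [List.getElem?_cons_zero, hx, true_iff]
          exact ⟨_, List.mem_map_of_mem hq, by simpa using hq₀, by simp⟩
        | succ i =>
          rw [List.getElem?_cons_succ, h i]
          simp only [List.mem_map, exists_exists_and_eq_and]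
          refine exists_congr fun q => and_congr_right fun _ => ?_
          split_ifs
          · simp; omega
          · simp
      · refine ⟨(0, 0) :: l.map fun q => (q.1 + 1, q.2 + 1), by simp [zeroRuns, hl, hx, hxs], ?_⟩
        rintro (_ | i)
        · simp [hx]
        · simp [h i]
    · refine ⟨l.map fun q => (q.1 + 1, q.2 + 1), by simp [zeroRuns, hl, hx], ?_⟩
      rintro (_ | i)
      · simp [hx]
      · simp [h i]

lemma setWidth_le_zeroRuns {S : Finset ℕ} {u : List ℤ} (h : ∀ i, i ∈ S ↔ u[i]? = some 0) :
    setWidth S ≤ zeroRuns u := by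
  obtain ⟨l, hl, hu⟩ := exists_intervals u
  rw [← hl]
  refine Nat.sInf_le ⟨fun k => l[k], ?_⟩
  ext i
  simp only [Finset.mem_coe, h, hu, Set.mem_iUnion, Set.mem_Icc]
  constructor
  · rintro ⟨q, hq, hi⟩
    obtain ⟨k, hk, rfl⟩ := List.mem_iff_getElem.1 hq
    exact ⟨⟨k, hk⟩, hi⟩
  · rintro ⟨k, hk⟩
    exact ⟨_, List.getElem_mem k.2, hk⟩

lemma Erases.exists_pairs {B : ℕ} {u v : List ℤ} (h : Erases B u v) (hv : ∀ x ∈ v, x = 0) :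
    ∃ l : List (ℕ × ℕ), (l.flatMap fun q => [q.1, q.2]).Nodup ∧
      (∀ i, (i ∈ l.flatMap fun q => [q.1, q.2]) ↔ i < u.length ∧ u[i]? ≠ some 0) ∧
      (∀ q ∈ l, q.1 < q.2 ∧ u[q.1]? = some 1 ∧ u[q.2]? = some (-1)) ∧
      ∀ t, ∀ S : Finset ℕ,
        (∀ i, i ∈ S ↔ u[i]? = some 0 ∨ i ∈ (l.take t).flatMap fun q => [q.1, q.2]) →
        setWidth S ≤ B := by
  induction h with
  | refl u hr =>
    refine ⟨[], by simp, fun i => ?_, by simp, fun t S hS => ?_⟩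
    · simp only [List.flatMap_nil, List.not_mem_nil, false_iff, not_and, not_not]
      intro hi
      rw [List.getElem?_eq_getElem hi, hv _ (List.getElem_mem hi)]
    · exact (setWidth_le_zeroRuns (u := u) (by simpa using hS)).trans hr
  | step a b c w hr _ ih =>
    obtain ⟨l, hnd, hmem, hl, hS⟩ := ih hv
    have hother : ∀ i, i ≠ a.length → i ≠ a.length + 1 + b.length →
        (a ++ 0 :: (b ++ 0 :: c))[i]? = (a ++ 1 :: (b ++ -1 :: c))[i]? := by
      intro i h₁ h₂
      grind
    have hp : (a ++ 1 :: (b ++ -1 :: c))[a.length]? = some 1 := by grind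
    have hm : (a ++ 1 :: (b ++ -1 :: c))[a.length + 1 + b.length]? = some (-1) := by grind
    have hp' : (a ++ 0 :: (b ++ 0 :: c))[a.length]? = some (0 : ℤ) := by grind
    have hm' : (a ++ 0 :: (b ++ 0 :: c))[a.length + 1 + b.length]? = some (0 : ℤ) := by grind
    have hlen : (a ++ 0 :: (b ++ 0 :: c)).length = (a ++ 1 :: (b ++ -1 :: c)).length := by simp
    have hlm : a.length + 1 + b.length < (a ++ 1 :: (b ++ -1 :: c)).length := by simp; omega
    generalize a ++ 1 :: (b ++ -1 :: c) = u at *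
    generalize a ++ 0 :: (b ++ 0 :: c) = u' at *
    generalize hx : a.length = x at *
    generalize hy : x + 1 + b.length = y at *
    have hxy : x < y := by omega
    refine ⟨(x, y) :: l, ?_, fun i => ?_, ?_, fun t S h => ?_⟩
    · simp only [List.flatMap_cons, List.cons_append, List.nil_append, List.nodup_cons,
        List.mem_cons, hmem]
      grind
    · simp only [List.flatMap_cons, List.cons_append, List.nil_append, List.mem_cons, hmem]
      grind
    · grind
    · cases t with
      | zero => exact (setWidth_le_zeroRuns (u := u) (by simpa using h)).trans hr
      | succ t =>
        refine hS t S fun i => ?_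
        simp only [h, List.take_succ_cons, List.flatMap_cons, List.cons_append, List.nil_append,
          List.mem_cons]
        grind

lemma dyckWidth_le_of_erases {B q : ℕ} {u : List ℤ} (hu : 0 ∉ u)
    (h : Erases B u (List.replicate q 0)) : dyckWidth u ≤ B := by
  obtain ⟨l, hnd, hmem, hl, hS⟩ := h.exists_pairs (by simp)
  have hu' : ∀ i : ℕ, u[i]? ≠ some 0 := fun i hi => hu (List.mem_of_getElem? hi)
  let p : RePairing u :=
    { pairs := l
      perm := (List.perm_ext_iff_of_nodup hnd List.nodup_range).2 fun i => by simp [hmem, hu']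
      lt := fun q hq => (hl q hq).1
      plus := fun q hq => by simp [List.getD, (hl q hq).2.1]
      minus := fun q hq => by simp [List.getD, (hl q hq).2.2] }
  have hp : repWidth p ≤ B := Finset.sup_le fun t _ => hS t _ fun i => by
    simp [hu' i, p]
  have : dyckWidth u ≤ repWidth p := Nat.sInf_le ⟨p, rfl⟩
  exact this.trans hp

lemma dyckWidth_Zword_le (n : ℕ) : dyckWidth (Zword n) ≤ 4 * Nat.clog 2 n + 1 := by
  obtain ⟨q, hq⟩ := erases_Zword_of_le_two_pow (Nat.le_pow_clog (b := 2) (by norm_num) n)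
  exact dyckWidth_le_of_erases (zero_notMem_Zword n) hq

/-- width(Z(n)) = 2^{O(√(log n))}. -/
theorem dyckWidth_Zword_upper : ∃ a b : ℝ, 0 < a ∧ 0 < b ∧
    ∀ n : ℕ, 1 ≤ n →
      (dyckWidth (Zword n) : ℝ) ≤ a * 2 ^ (b * Real.sqrt (Real.logb 2 (n : ℝ))) := by
  refine ⟨5, 4, by norm_num, by norm_num, fun n hn => ?_⟩
  set L := Real.logb 2 (n : ℝ) with hL
  have hn' : (1 : ℝ) ≤ n := by exact_mod_cast hn
  have hL₀ : 0 ≤ L := Real.logb_nonneg (by norm_num) hn'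
  have hlog : ((Nat.clog 2 n : ℕ) : ℝ) ≤ L + 1 := by
    have h₁ : Nat.clog 2 n ≤ Nat.log 2 n + 1 := Nat.clog_le_of_le_pow
      (Nat.lt_pow_succ_log_self (by norm_num) n).le
    have h₂ : ((Nat.log 2 n : ℕ) : ℝ) ≤ L := by
      simpa using Real.natLog_le_logb n 2
    have h₃ : ((Nat.clog 2 n : ℕ) : ℝ) ≤ (Nat.log 2 n : ℕ) + 1 := by exact_mod_cast h₁
    linarith
  have hw : (dyckWidth (Zword n) : ℝ) ≤ 4 * (Nat.clog 2 n : ℕ) + 1 := by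
    exact_mod_cast dyckWidth_Zword_le n
  have hs : Real.sqrt L ^ 2 = L := Real.sq_sqrt hL₀
  have hs₀ := Real.sqrt_nonneg L
  have hexp : 1 + 2 * Real.sqrt L + (2 * Real.sqrt L) ^ 2 / 2 ≤ (2 : ℝ) ^ (4 * Real.sqrt L) := by
    rw [Real.rpow_def_of_pos (by norm_num)]
    refine (Real.quadratic_le_exp_of_nonneg (by positivity)).trans (Real.exp_le_exp.2 ?_)
    nlinarith [Real.log_two_gt_d9]
  nlinarith
end

section
/- There exists a sequence of Dyck words (W_n) with |W_n| → ∞ and a constant c > 0 such that width(W_n) ≥ c · √( log |W_n| / log log |W_n| ) for all sufficiently large n. -/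
open Finset in
/-- The number of adjacent positions `p, p + 1` in `[a, b)` of which exactly one lies in `E`. -/
def boundaryCount (E : Finset ℕ) (a b : ℕ) : ℕ :=
  #{p ∈ Ico a b | p + 1 < b ∧ ¬(p ∈ E ↔ p + 1 ∈ E)}

/-- The sum of the letters of the word with height function `H` at the positions of `E`
that are smaller than `x`. -/
def erasedSum (H : ℕ → ℤ) (E : Finset ℕ) (x : ℕ) : ℤ :=
  ∑ p ∈ Finset.range x, if p ∈ E then H (p + 1) - H p else 0

theorem erasedSum_zero (H : ℕ → ℤ) (E : Finset ℕ) : erasedSum H E 0 = 0 :=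
  Finset.sum_range_zero _

theorem erasedSum_succ (H : ℕ → ℤ) (E : Finset ℕ) (x : ℕ) :
    erasedSum H E (x + 1) = erasedSum H E x + if x ∈ E then H (x + 1) - H x else 0 :=
  Finset.sum_range_succ _ _

theorem erasedSum_of_forall_mem {H : ℕ → ℤ} {E : Finset ℕ} {a b : ℕ} (hab : a ≤ b)
    (h : ∀ p, a ≤ p → p < b → p ∈ E) : erasedSum H E b = erasedSum H E a + (H b - H a) := by
  induction b, hab using Nat.le_induction with
  | base => simp
  | succ b hb ih =>
    rw [erasedSum_succ, if_pos (h b hb (by omega)), ih fun p h1 h2 => h p h1 (by omega)]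
    ring

theorem erasedSum_of_forall_notMem {H : ℕ → ℤ} {E : Finset ℕ} {a b : ℕ} (hab : a ≤ b)
    (h : ∀ p, a ≤ p → p < b → p ∉ E) : erasedSum H E b = erasedSum H E a := by
  induction b, hab using Nat.le_induction with
  | base => simp
  | succ b hb ih =>
    rw [erasedSum_succ, if_neg (h b hb (by omega)), ih fun p h1 h2 => h p h1 (by omega)]
    ring

theorem mem_iff_of_boundaryCount_eq_zero {E : Finset ℕ} {a b : ℕ} (h : boundaryCount E a b = 0)
    {p q : ℕ} (hp : a ≤ p) (hpq : p ≤ q) (hq : q < b) : p ∈ E ↔ q ∈ E := by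
  rw [boundaryCount, Finset.card_eq_zero, Finset.filter_eq_empty_iff] at h
  induction q, hpq using Nat.le_induction with
  | base => rfl
  | succ q hpq ih =>
    have := @h q (by simp only [Finset.mem_Ico]; omega)
    rw [ih (by omega)]
    tauto

theorem exists_mem_and_exists_notMem_of_boundaryCount_pos {E : Finset ℕ} {a b : ℕ}
    (h : 0 < boundaryCount E a b) :
    (∃ p, a ≤ p ∧ p < b ∧ p ∈ E) ∧ ∃ p, a ≤ p ∧ p < b ∧ p ∉ E := by
  obtain ⟨p, hp⟩ := Finset.card_pos.mp h
  simp only [Finset.mem_filter, Finset.mem_Ico] at hp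
  by_cases hE : p ∈ E
  · exact ⟨⟨p, by omega, by omega, hE⟩, p + 1, by omega, by omega, by tauto⟩
  · exact ⟨⟨p + 1, by omega, by omega, by tauto⟩, p, by omega, by omega, hE⟩

theorem boundaryCount_add_le (E : Finset ℕ) {a c d b : ℕ} (hac : a ≤ c) (hcd : c < d)
    (hdb : d ≤ b) :
    boundaryCount E a (c + 1) + boundaryCount E c d + boundaryCount E (d - 1) b
      ≤ boundaryCount E a b := by
  unfold boundaryCount
  rw [← Finset.card_union_of_disjoint, ← Finset.card_union_of_disjoint]
  · apply Finset.card_le_card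
    intro p
    simp only [Finset.mem_union, Finset.mem_filter, Finset.mem_Ico]
    rintro ((⟨h1, h2, h3⟩ | ⟨h1, h2, h3⟩) | ⟨h1, h2, h3⟩) <;>
      exact ⟨by omega, by omega, h3⟩
  · rw [Finset.disjoint_left]
    intro p
    simp only [Finset.mem_union, Finset.mem_filter, Finset.mem_Ico]
    omega
  · rw [Finset.disjoint_left]
    intro p
    simp only [Finset.mem_filter, Finset.mem_Ico]
    omega

theorem boundaryCount_succ (E : Finset ℕ) {a b : ℕ} (hab : a < b) :
    boundaryCount E a (b + 1) =
      boundaryCount E a b + if (b - 1 ∈ E ↔ b ∈ E) then 0 else 1 := by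
  unfold boundaryCount
  obtain ⟨b, rfl⟩ : ∃ c, b = c + 1 := ⟨b - 1, by omega⟩
  have key : ∀ p ∈ Finset.Ico a (b + 1 + 1),
      (p + 1 < b + 1 + 1 ∧ ¬(p ∈ E ↔ p + 1 ∈ E)) ↔
        (p + 1 < b + 1 ∧ ¬(p ∈ E ↔ p + 1 ∈ E)) ∨ (p = b ∧ ¬(b ∈ E ↔ b + 1 ∈ E)) := by
    intro p _
    by_cases hp : p = b
    · subst hp; simp
    · have : p + 1 < b + 1 + 1 ↔ p + 1 < b + 1 := by omega
      simp [hp, this]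
  rw [Finset.filter_congr key, Finset.filter_or, Finset.card_union_of_disjoint]
  · congr 1
    · congr 1
      ext p
      simp only [Finset.mem_filter, Finset.mem_Ico]
      refine ⟨fun h => ⟨by omega, h.2⟩, fun h => ⟨by omega, h.2⟩⟩
    · simp only [Nat.add_sub_cancel]
      split_ifs with h
      · simp [h]
      · simp only [h, not_false_eq_true, and_true]
        rw [Finset.card_eq_one]
        refine ⟨b, ?_⟩
        ext p
        simp only [Finset.mem_filter, Finset.mem_Ico, Finset.mem_singleton]
        omega
  · rw [Finset.disjoint_left]
    intro p
    simp only [Finset.mem_filter]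
    omega

theorem abs_erasedSum_sub_le {H : ℕ → ℤ} {E : Finset ℕ} {a b : ℕ} {h : ℤ} (hab : a < b)
    (hH : ∀ p, a ≤ p → p ≤ b → H a ≤ H p ∧ H p ≤ H a + h) :
    |erasedSum H E b - erasedSum H E a| ≤ (boundaryCount E a b + 1) * h := by
  have key : |erasedSum H E b - erasedSum H E a - if b - 1 ∈ E then H b - H a else 0|
      ≤ boundaryCount E a b * h := by
    have hh : 0 ≤ h := by have := hH a le_rfl hab.le; omega
    induction b, hab using Nat.le_induction with
    | base =>
      rw [erasedSum_succ]
      simp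
      positivity
    | succ b hb ih =>
      have ih := ih fun p h1 h2 => hH p h1 (by omega)
      have hHb := hH b (by omega) (by omega)
      rw [boundaryCount_succ E (by omega), erasedSum_succ]
      simp only [Nat.add_sub_cancel]
      rw [abs_le] at ih ⊢
      split_ifs at ih ⊢ <;> first | tauto | (push_cast; constructor <;> linarith)
  have hHb := hH b hab.le le_rfl
  rw [abs_le] at key ⊢
  split_ifs at key <;> constructor <;> linarith

/-- If every factor `[x + i B + a, x + i B + a + L)`, `i < m`, of a long enough periodic factor
starting at `x` has at some time at least `N` boundaries of the erased set, then the whole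
periodic factor has at some time more than `N` of them. -/
theorem exists_boundaryCount_gt {H : ℕ → ℤ} {E : ℕ → Finset ℕ} {x L a m N B : ℕ} {h M : ℤ}
    (hB : B = L + 2 * a) (hE : ∀ s t, s ≤ t → E s ⊆ E t)
    (hS : ∀ s t y, s ≤ t → y ≤ x + m * B → erasedSum H (E s) y ≤ erasedSum H (E t) y)
    (hS0 : ∀ t, 0 ≤ erasedSum H (E t) x) (hSM : ∀ t, erasedSum H (E t) x ≤ M)
    (hM : M + 2 < m) (hL : 0 < L) (hN : 0 < N) (hh : (N + 1) * h + 1 ≤ a) (ha : 0 < a)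
    (hH0 : ∀ i ≤ m, H (x + i * B) = H x)
    (hHa : ∀ i < m, H (x + i * B + a) = H x + a)
    (hHL : ∀ i < m, H (x + i * B + a + L) = H x + a)
    (hHh : ∀ i < m, ∀ p ≤ L, H x + a ≤ H (x + i * B + a + p) ∧
      H (x + i * B + a + p) ≤ H x + a + h)
    (hT : ∀ i < m, ∃ t, N ≤ boundaryCount (E t) (x + i * B + a) (x + i * B + a + L)) :
    ∃ t, N < boundaryCount (E t) x (x + m * B) := by
  by_contra! hcon
  have hM0 : 0 ≤ M := (hS0 0).trans (hSM 0)
  have hm : 2 < m := by omega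
  have hh0 : 0 ≤ h := by have := hHh 0 (by omega) 0 (by omega); omega
  choose! T hT using hT
  have hiB : ∀ i i', i < i' → i * B + B ≤ i' * B := fun i i' hi => by nlinarith
  have hsplit : ∀ i < m,
      boundaryCount (E (T i)) x (x + i * B + a + 1) = 0 ∧
      boundaryCount (E (T i)) (x + i * B + a + L - 1) (x + m * B) = 0 ∧
      boundaryCount (E (T i)) (x + i * B + a) (x + i * B + a + L) ≤ N := by
    intro i hi
    have h1 := boundaryCount_add_le (E (T i)) (a := x) (c := x + i * B + a)
      (d := x + i * B + a + L) (b := x + m * B) (by omega) (by omega)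
      (by have := hiB i m hi; omega)
    have := hcon (T i)
    have := hT i hi
    omega
  have hleft : ∀ i < m, ∀ p, x ≤ p → p ≤ x + i * B + a → (p ∈ E (T i) ↔ x ∈ E (T i)) :=
    fun i hi p h1 h2 =>
      (mem_iff_of_boundaryCount_eq_zero (hsplit i hi).1 le_rfl h1 (by omega)).symm
  have hright : ∀ i < m, ∀ p, x + i * B + a + L - 1 ≤ p → p < x + m * B →
      (p ∈ E (T i) ↔ x + m * B - 1 ∈ E (T i)) :=
    fun i hi p h1 h2 =>
      mem_iff_of_boundaryCount_eq_zero (hsplit i hi).2.1 h1 (by omega) (by omega)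
  have hmix := fun i (hi : i < m) =>
    exists_mem_and_exists_notMem_of_boundaryCount_pos (hN.trans_le (hT i hi))
  have hlt : ∀ i i', i < i' → i' < m → T i ≤ T i' →
      x ∈ E (T i') ∧ x + m * B - 1 ∉ E (T i) := by
    intro i i' hi hi' hTT
    have h1 := hiB i i' hi
    have h2 := hiB i' m hi'
    obtain ⟨⟨p, hp1, hp2, hp⟩, -⟩ := hmix i (by omega)
    obtain ⟨-, q, hq1, hq2, hq⟩ := hmix i' hi'
    refine ⟨(hleft i' hi' p (by omega) (by omega)).1 (hE _ _ hTT hp), fun hl => hq ?_⟩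
    exact hE _ _ hTT ((hright i (by omega) q (by omega) (by omega)).2 hl)
  have hgt : ∀ i i', i < i' → i' < m → T i' ≤ T i →
      x ∉ E (T i') ∧ x + m * B - 1 ∈ E (T i) := by
    intro i i' hi hi' hTT
    have h1 := hiB i i' hi
    have h2 := hiB i' m hi'
    obtain ⟨-, q, hq1, hq2, hq⟩ := hmix i (by omega)
    obtain ⟨⟨p, hp1, hp2, hp⟩, -⟩ := hmix i' hi'
    refine ⟨fun hl => hq ?_, (hright i (by omega) p (by omega) (by omega)).1 (hE _ _ hTT hp)⟩
    exact hE _ _ hTT ((hleft i' hi' q (by omega) (by omega)).2 hl)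
  have hmid : ∀ i < m, |erasedSum H (E (T i)) (x + i * B + a + L) -
      erasedSum H (E (T i)) (x + i * B + a)| ≤ (N + 1) * h := by
    intro i hi
    refine (abs_erasedSum_sub_le (h := h) (by omega) ?_).trans ?_
    · intro p hp1 hp2
      have := hHh i hi (p - (x + i * B + a)) (by omega)
      rw [Nat.add_sub_cancel' hp1] at this
      rwa [hHa i hi]
    · have := (hsplit i hi).2.2
      gcongr
  rcases le_total (T 0) (T 1) with h01 | h01
  · have hv0 := (hlt 0 1 (by omega) (by omega) h01).2
    have hu : ∀ i, 0 < i → i < m → x ∈ E (T i) := fun i h0 him =>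
      (hlt 0 i h0 him ((le_total _ _).resolve_right fun hc => hv0 (hgt 0 i h0 him hc).2)).1
    have hTT : ∀ i i', 0 < i → i < i' → i' < m → T i ≤ T i' := fun i i' h0 hi him =>
      (le_total _ _).resolve_right fun hc => (hgt i i' hi him hc).1 (hu i' (by omega) him)
    have hleft' : ∀ i, 0 < i → i < m →
        erasedSum H (E (T i)) (x + i * B) = erasedSum H (E (T i)) x := by
      intro i h0 him
      rw [erasedSum_of_forall_mem (a := x) (by omega) fun p h1 h2 =>
        (hleft i him p h1 (by omega)).2 (hu i h0 him), hH0 i him.le]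
      ring
    have hD : ∀ n, n + 1 < m → erasedSum H (E (T 1)) x + n ≤ erasedSum H (E (T (n + 1))) x := by
      intro n
      induction n with
      | zero => simp
      | succ n ih =>
        intro hn
        have ih := ih (by omega)
        have h1 := hmid (n + 1) (by omega)
        have h2 := hS (T (n + 1)) (T (n + 2)) (x + (n + 2) * B)
          (hTT _ _ (by omega) (by omega) hn)
          (by have := hiB (n + 2) m hn; omega)
        rw [hleft' (n + 2) (by omega) hn] at h2
        have h4 : x + (n + 2) * B = x + (n + 1) * B + a + L + a := by rw [hB]; ring
        have h3 : erasedSum H (E (T (n + 1))) (x + (n + 2) * B) =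
            erasedSum H (E (T (n + 1))) (x + (n + 1) * B + a + L) := by
          have hl := (hlt (n + 1) (n + 2) (by omega) hn (hTT _ _ (by omega) (by omega) hn)).2
          refine erasedSum_of_forall_notMem (by omega) fun p hp1 hp2 hp => hl ?_
          have := hiB (n + 2) m hn
          exact (hright (n + 1) (by omega) p (by omega) (by omega)).1 hp
        have h5 : erasedSum H (E (T (n + 1))) (x + (n + 1) * B + a) =
            erasedSum H (E (T (n + 1))) x + a := by
          rw [erasedSum_of_forall_mem (a := x) (by omega) fun p h1 h2 =>
            (hleft (n + 1) (by omega) p h1 (by omega)).2 (hu (n + 1) (by omega) (by omega)),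
            hHa (n + 1) (by omega)]
          ring
        rw [abs_le] at h1
        push_cast
        linarith
    have := hD (m - 2) (by omega)
    have := hS0 (T 1)
    have := hSM (T (m - 2 + 1))
    omega
  · have hv0 := (hgt 0 1 (by omega) (by omega) h01).2
    have hu : ∀ i, 0 < i → i < m → x ∉ E (T i) := fun i h0 him =>
      (hgt 0 i h0 him ((le_total _ _).resolve_right fun hc => (hlt 0 i h0 him hc).2 hv0)).1
    have hTT : ∀ i i', 0 < i → i < i' → i' < m → T i' ≤ T i := fun i i' h0 hi him =>
      (le_total _ _).resolve_right fun hc => hu i' (by omega) him (hlt i i' hi him hc).1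
    have hleft' : ∀ i, 0 < i → i < m → ∀ y, x ≤ y → y ≤ x + i * B + a →
        erasedSum H (E (T i)) y = erasedSum H (E (T i)) x := by
      intro i h0 him y hy1 hy2
      exact erasedSum_of_forall_notMem hy1 fun p h1 h2 h3 => hu i h0 him
        ((hleft i him p h1 (by omega)).1 h3)
    have hD : ∀ n, n + 1 < m → erasedSum H (E (T (n + 1))) x ≤ erasedSum H (E (T 1)) x - n := by
      intro n
      induction n with
      | zero => simp
      | succ n ih =>
        intro hn
        have ih := ih (by omega)
        have h1 := hmid (n + 1) (by omega)
        have h2 := hS (T (n + 2)) (T (n + 1)) (x + (n + 2) * B)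
          (hTT _ _ (by omega) (by omega) hn)
          (by have := hiB (n + 2) m hn; omega)
        rw [hleft' (n + 2) (by omega) hn _ (by omega) (by omega)] at h2
        have h4 : x + (n + 2) * B = x + (n + 1) * B + a + L + a := by rw [hB]; ring
        have h3 : erasedSum H (E (T (n + 1))) (x + (n + 2) * B) =
            erasedSum H (E (T (n + 1))) (x + (n + 1) * B + a + L) - a := by
          have hl := (hgt (n + 1) (n + 2) (by omega) hn (hTT _ _ (by omega) (by omega) hn)).2
          have := hiB (n + 2) m hn
          rw [erasedSum_of_forall_mem (a := x + (n + 1) * B + a + L) (by omega) fun p hp1 hp2 =>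
            (hright (n + 1) (by omega) p (by omega) (by omega)).2 hl,
            hH0 (n + 2) (by omega), hHL (n + 1) (by omega)]
          ring
        have h5 := hleft' (n + 1) (by omega) (by omega) (x + (n + 1) * B + a)
          (by omega) le_rfl
        rw [abs_le] at h1
        push_cast
        linarith
    have := hD (m - 2) (by omega)
    have := hSM (T 1)
    have := hS0 (T (m - 2 + 1))
    omega

/-- The length of the `j`-th ridge word; the first one is `+-+-`, and the next one consists of `m`
copies of the current one, each framed by runs of `K * (K + 1) ^ j` letters. -/
def ridgeLength (K m : ℕ) : ℕ → ℕ
  | 0 => 4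
  | j + 1 => m * (ridgeLength K m j + 2 * (K * (K + 1) ^ j))

/-- The height function of the `j`-th ridge word. -/
def ridgeHeight (K m : ℕ) : ℕ → ℕ → ℤ
  | 0, n => (n % 2 : ℕ)
  | j + 1, n =>
    let a := K * (K + 1) ^ j
    let B := ridgeLength K m j + 2 * a
    if n % B ≤ a then (n % B : ℕ)
    else if n % B ≤ a + ridgeLength K m j then a + ridgeHeight K m j (n % B - a)
    else B - (n % B : ℕ)

theorem ridgeHeight_zero_right (K m j : ℕ) : ridgeHeight K m j 0 = 0 := by
  cases j <;> simp [ridgeHeight]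

theorem ridgeHeight_mul_period (K m j i : ℕ) :
    ridgeHeight K m (j + 1) (i * (ridgeLength K m j + 2 * (K * (K + 1) ^ j))) = 0 := by
  simp [ridgeHeight]

theorem ridgeHeight_length (K m j : ℕ) : ridgeHeight K m j (ridgeLength K m j) = 0 := by
  cases j with
  | zero => simp [ridgeHeight, ridgeLength]
  | succ j => exact ridgeHeight_mul_period K m j m

theorem ridgeHeight_copy {K m j : ℕ} (hK : 0 < K) (i : ℕ) {p : ℕ} (hp : p ≤ ridgeLength K m j) :
    ridgeHeight K m (j + 1)
        (i * (ridgeLength K m j + 2 * (K * (K + 1) ^ j)) + K * (K + 1) ^ j + p) =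
      (K * (K + 1) ^ j : ℕ) + ridgeHeight K m j p := by
  have ha : 0 < K * (K + 1) ^ j := by positivity
  simp only [ridgeHeight]
  generalize K * (K + 1) ^ j = a at *
  rw [show i * (ridgeLength K m j + 2 * a) + a + p =
    a + p + (ridgeLength K m j + 2 * a) * i by ring, Nat.add_mul_mod_self_left,
    Nat.mod_eq_of_lt (by omega)]
  rcases Nat.eq_zero_or_pos p with rfl | hp0
  · simp [ridgeHeight_zero_right]
  · rw [if_neg (by omega), if_pos (by omega), Nat.add_sub_cancel_left]

theorem ridgeHeight_bounds {K : ℕ} (hK : 0 < K) (m j n : ℕ) :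
    0 ≤ ridgeHeight K m j n ∧ ridgeHeight K m j n ≤ (K + 1) ^ j := by
  induction j generalizing n with
  | zero => simp only [ridgeHeight, pow_zero]; omega
  | succ j ih =>
    have ha : 0 < K * (K + 1) ^ j := by positivity
    have hpow : ((K : ℤ) + 1) ^ (j + 1) = (K * (K + 1) ^ j : ℕ) + (K + 1) ^ j := by
      push_cast; ring
    have hpos : (0 : ℤ) < ((K : ℤ) + 1) ^ j := by positivity
    simp only [ridgeHeight]
    rw [hpow]
    generalize K * (K + 1) ^ j = a at *
    have hmod := Nat.mod_lt n (show 0 < ridgeLength K m j + 2 * a by omega)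
    generalize n % (ridgeLength K m j + 2 * a) = r at *
    have := ih (r - a)
    split_ifs <;> constructor <;> omega

theorem ridgeHeight_succ_sub {K : ℕ} (hK : 0 < K) (m j n : ℕ) :
    ridgeHeight K m j (n + 1) - ridgeHeight K m j n = 1 ∨
      ridgeHeight K m j (n + 1) - ridgeHeight K m j n = -1 := by
  induction j generalizing n with
  | zero => simp only [ridgeHeight]; omega
  | succ j ih =>
    have ha : 0 < K * (K + 1) ^ j := by positivity
    have h0 := ridgeHeight_zero_right K m j
    have h1 := ridgeHeight_length K m j
    simp only [ridgeHeight]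
    generalize K * (K + 1) ^ j = a at *
    set B := ridgeLength K m j + 2 * a with hB
    have hmod := Nat.mod_lt n (show 0 < B by omega)
    have hsucc : (n + 1) % B = if n % B + 1 = B then 0 else n % B + 1 := by
      rw [Nat.add_mod]
      split_ifs with h
      · rw [Nat.mod_eq_of_lt (show 1 < B by omega), h, Nat.mod_self]
      · rw [Nat.mod_eq_of_lt (show 1 < B by omega), Nat.mod_eq_of_lt (by omega)]
    rw [hsucc]
    generalize n % B = r at *
    rcases lt_trichotomy r a with hr | hr | hr
    · rw [if_neg (by omega : ¬ r + 1 = B), if_pos (by omega), if_pos (by omega)]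
      omega
    · subst hr
      rw [if_pos (le_refl r)]
      by_cases h2 : r + 1 = B
      · rw [if_pos h2, if_pos (by omega)]
        omega
      · rw [if_neg h2, if_neg (by omega)]
        split_ifs with h3
        · have := ih 0
          rw [h0, zero_add] at this
          rw [Nat.add_sub_cancel_left]
          omega
        · omega
    · rw [if_neg (by omega : ¬ r ≤ a)]
      rcases lt_trichotomy r (a + ridgeLength K m j) with hr' | hr' | hr'
      · rw [if_neg (by omega : ¬ r + 1 = B), if_neg (by omega), if_pos (by omega),
          if_pos (by omega), show r + 1 - a = r - a + 1 by omega]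
        have := ih (r - a)
        omega
      · rw [if_pos (by omega : r ≤ _), show r - a = ridgeLength K m j by omega, h1]
        by_cases h2 : r + 1 = B
        · rw [if_pos h2, if_pos (by omega)]
          omega
        · rw [if_neg h2, if_neg (by omega), if_neg (by omega)]
          omega
      · rw [if_neg (by omega : ¬ r ≤ _)]
        by_cases h2 : r + 1 = B
        · rw [if_pos h2, if_pos (by omega)]
          omega
        · rw [if_neg h2, if_neg (by omega), if_neg (by omega)]
          omega

theorem ridgeLength_pos {K m : ℕ} (hK : 0 < K) (hm : 0 < m) (j : ℕ) : 0 < ridgeLength K m j := by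
  cases j with
  | zero => simp [ridgeLength]
  | succ j => simp only [ridgeLength]; positivity

theorem pow_le_ridgeLength (K m j : ℕ) : m ^ j ≤ ridgeLength K m j := by
  induction j with
  | zero => simp [ridgeLength]
  | succ j ih =>
    rw [ridgeLength, pow_succ, mul_comm]
    gcongr
    omega

theorem ridgeLength_le {K m j : ℕ} (hm : (K + 1) ^ (j + 1) ≤ m) :
    ridgeLength K m j ≤ (4 * m) ^ (j + 1) := by
  have hm0 : 0 < m := lt_of_lt_of_le (by positivity) hm
  induction j with
  | zero => simp only [ridgeLength, zero_add, pow_one]; omega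
  | succ j ih =>
    have hle : (K + 1) ^ (j + 1) ≤ m := (Nat.pow_le_pow_right (by omega) (by omega)).trans hm
    have ih := ih hle
    have ha : K * (K + 1) ^ j ≤ m := by
      refine le_trans ?_ hle
      rw [pow_succ, mul_comm]
      gcongr
      omega
    have h1 : m ≤ (4 * m) ^ (j + 1) :=
      (by omega : m ≤ 4 * m).trans (Nat.le_self_pow (by omega) _)
    calc ridgeLength K m (j + 1) ≤ m * ((4 * m) ^ (j + 1) + 2 * (4 * m) ^ (j + 1)) := by
          rw [ridgeLength]; gcongr; omega
      _ ≤ (4 * m) ^ (j + 1 + 1) := by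
          rw [pow_succ (4 * m) (j + 1)]; nlinarith [Nat.zero_le (m * (4 * m) ^ (j + 1))]

theorem exists_lt_boundaryCount_ridge {K m l : ℕ} {E : ℕ → Finset ℕ} (hK : l + 3 ≤ K)
    (hm : (K + 1) ^ l + 2 < m) (hE : ∀ s t, s ≤ t → E s ⊆ E t)
    (hS : ∀ s t y, s ≤ t → y ≤ ridgeLength K m l →
      erasedSum (ridgeHeight K m l) (E s) y ≤ erasedSum (ridgeHeight K m l) (E t) y)
    (hS0 : ∀ t x, x ≤ ridgeLength K m l → 0 ≤ erasedSum (ridgeHeight K m l) (E t) x)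
    (hSM : ∀ t x, x ≤ ridgeLength K m l →
      erasedSum (ridgeHeight K m l) (E t) x ≤ ridgeHeight K m l x)
    (hbase : ∀ x, x + 4 ≤ ridgeLength K m l → ∃ t, 0 < boundaryCount (E t) x (x + 4))
    {j : ℕ} (hj : j ≤ l) {x : ℕ} (hx : x + ridgeLength K m j ≤ ridgeLength K m l)
    (hcopy : ∀ p ≤ ridgeLength K m j,
      ridgeHeight K m l (x + p) = ridgeHeight K m l x + ridgeHeight K m j p) :
    ∃ t, j < boundaryCount (E t) x (x + ridgeLength K m j) := by
  have hK0 : 0 < K := by omega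
  have hm0 : 0 < m := by omega
  induction j generalizing x with
  | zero => exact hbase x hx
  | succ j ih =>
    have hperiod := ridgeHeight_mul_period K m j
    have hcopy' := fun i p => ridgeHeight_copy (m := m) (j := j) hK0 i (p := p)
    have ha : 0 < K * (K + 1) ^ j := by positivity
    have hab : ((j + 1 : ℕ) + 1 : ℤ) * (K + 1) ^ j + 1 ≤ (K * (K + 1) ^ j : ℕ) := by
      have hpos : (1 : ℤ) ≤ (K + 1) ^ j := by exact_mod_cast Nat.one_le_pow _ _ (by omega)
      have : (j : ℤ) + 3 ≤ K := by omega
      push_cast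
      nlinarith
    rw [ridgeLength] at hx hcopy ⊢
    set a := K * (K + 1) ^ j
    set L := ridgeLength K m j
    have hL : 0 < L := ridgeLength_pos hK0 hm0 j
    have hblock : ∀ i < m, i * (L + 2 * a) + (L + 2 * a) ≤ m * (L + 2 * a) := fun i hi => by
      rw [← Nat.succ_mul]; exact Nat.mul_le_mul_right _ hi
    have hH : ∀ i < m, ∀ p ≤ L, ridgeHeight K m l (x + i * (L + 2 * a) + a + p) =
        ridgeHeight K m l x + a + ridgeHeight K m j p := by
      intro i hi p hp
      have := hblock i hi
      rw [show x + i * (L + 2 * a) + a + p = x + (i * (L + 2 * a) + a + p) by ring,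
        hcopy _ (by omega), hcopy' i p hp]
      ring
    have hHa : ∀ i < m, ridgeHeight K m l (x + i * (L + 2 * a) + a) =
        ridgeHeight K m l x + a := fun i hi => by
      have := hH i hi 0 (by omega)
      rwa [ridgeHeight_zero_right, add_zero, add_zero] at this
    refine exists_boundaryCount_gt (H := ridgeHeight K m l) (L := L) (a := a)
      (h := (K + 1) ^ j) (M := (K + 1) ^ l) rfl hE
      (fun s t y hst hy => hS s t y hst (by omega)) (fun t => hS0 t x (by omega))
      (fun t => (hSM t x (by omega)).trans (ridgeHeight_bounds hK0 m l x).2)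
      (by exact_mod_cast hm) hL (by omega) hab ha ?_ hHa ?_ ?_ ?_
    · intro i hi
      rw [hcopy _ (Nat.mul_le_mul_right _ hi), hperiod, add_zero]
    · intro i hi
      rw [hH i hi L le_rfl, ridgeHeight_length, add_zero]
    · intro i hi p hp
      have := ridgeHeight_bounds hK0 m j p
      rw [hH i hi p hp]
      constructor <;> linarith
    · intro i hi
      have := hblock i hi
      exact ih (by omega) (by omega) fun p hp => by rw [hH i hi p hp, hHa i hi]

/-- The word of length `L` with height function `H`. -/
def heightWord (H : ℕ → ℤ) (L : ℕ) : List ℤ :=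
  (List.range L).map fun p => H (p + 1) - H p

theorem length_heightWord (H : ℕ → ℤ) (L : ℕ) : (heightWord H L).length = L := by
  simp [heightWord]

theorem getD_heightWord (H : ℕ → ℤ) {L p : ℕ} (hp : p < L) :
    (heightWord H L).getD p 0 = H (p + 1) - H p := by
  simp [heightWord, hp]

theorem sum_heightWord (H : ℕ → ℤ) (L : ℕ) : (heightWord H L).sum = H L - H 0 := by
  induction L with
  | zero => simp [heightWord]
  | succ L ih =>
    rw [heightWord] at ih ⊢
    rw [List.range_succ, List.map_append, List.sum_append, ih]
    simp

theorem isDyck_heightWord {H : ℕ → ℤ} {L : ℕ} (h0 : H 0 = 0) (hL : H L = 0) (hpos : ∀ n, 0 ≤ H n)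
    (hstep : ∀ n, H (n + 1) - H n = 1 ∨ H (n + 1) - H n = -1) : IsDyck (heightWord H L) := by
  refine ⟨?_, by rw [sum_heightWord, h0, hL, sub_zero], fun k => ?_⟩
  · simp only [heightWord, List.mem_map]
    rintro a ⟨p, -, rfl⟩
    exact hstep p
  · have : (heightWord H L).take k = heightWord H (min k L) := by
      rw [heightWord, ← List.map_take, List.take_range, heightWord]
    rw [this, sum_heightWord, h0, sub_zero]
    exact hpos _

theorem exists_partial_pairing {H : ℕ → ℤ} (h0 : H 0 = 0) (hpos : ∀ n, 0 ≤ H n)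
    (hstep : ∀ n, H (n + 1) - H n = 1 ∨ H (n + 1) - H n = -1) (n : ℕ) :
    ∃ (P : List (ℕ × ℕ)) (U : List ℕ), (U.length : ℤ) = H n ∧
      (U ++ P.flatMap fun q => [q.1, q.2]).Perm (List.range n) ∧
      (∀ q ∈ P, q.1 < q.2 ∧ H (q.1 + 1) - H q.1 = 1 ∧ H (q.2 + 1) - H q.2 = -1) ∧
      ∀ u ∈ U, H (u + 1) - H u = 1 := by
  induction n with
  | zero => exact ⟨[], [], by simp [h0]⟩
  | succ n ih =>
    obtain ⟨P, U, hlen, hperm, hP, hU⟩ := ih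
    rw [List.range_succ]
    rcases hstep n with hn | hn
    · refine ⟨P, n :: U, by rw [List.length_cons]; push_cast; omega, ?_, hP, ?_⟩
      · rw [List.cons_append]
        exact (hperm.cons n).trans (List.perm_append_singleton n _).symm
      · rintro u (_ | ⟨_, hu⟩)
        exacts [hn, hU u hu]
    · cases U with
      | nil =>
        have := hpos (n + 1)
        rw [List.length_nil] at hlen
        omega
      | cons u U =>
        refine ⟨(u, n) :: P, U, by rw [List.length_cons] at hlen; push_cast at hlen; omega,
          ?_, ?_, fun v hv => hU v (List.mem_cons_of_mem _ hv)⟩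
        · have h1 : (U ++ ((u, n) :: P).flatMap fun q => [q.1, q.2]).Perm
              (n :: (u :: U ++ P.flatMap fun q => [q.1, q.2])) := by
            simp only [List.flatMap_cons, List.cons_append, List.nil_append]
            refine List.perm_middle.trans ?_
            exact (List.perm_middle.cons u).trans (List.Perm.swap _ _ _)
          exact h1.trans ((hperm.cons n).trans (List.perm_append_singleton n _).symm)
        · rintro q (_ | ⟨_, hq⟩)
          · refine ⟨?_, hU u (by simp), hn⟩
            have := hperm.subset (List.mem_append_left _ List.mem_cons_self)
            exact List.mem_range.1 this
          · exact hP q hq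

theorem nonempty_rePairing_heightWord {H : ℕ → ℤ} {L : ℕ} (h0 : H 0 = 0) (hL : H L = 0)
    (hpos : ∀ n, 0 ≤ H n) (hstep : ∀ n, H (n + 1) - H n = 1 ∨ H (n + 1) - H n = -1) :
    Nonempty (RePairing (heightWord H L)) := by
  obtain ⟨P, U, hlen, hperm, hP, -⟩ := exists_partial_pairing h0 hpos hstep L
  obtain rfl : U = [] := by rw [hL] at hlen; exact List.length_eq_zero_iff.1 (by omega)
  rw [List.nil_append] at hperm
  have hlt : ∀ q ∈ P, q.1 < L ∧ q.2 < L := fun q hq => by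
    constructor <;> refine List.mem_range.1 (hperm.subset (List.mem_flatMap.2 ⟨q, hq, ?_⟩)) <;> simp
  exact ⟨⟨P, by rwa [length_heightWord], fun q hq => (hP q hq).1,
    fun q hq => by rw [getD_heightWord H (hlt q hq).1, (hP q hq).2.1],
    fun q hq => by rw [getD_heightWord H (hlt q hq).2, (hP q hq).2.2]⟩⟩

/-- The set of positions erased within the first `t` pairs. -/
def RePairing.erased {w : List ℤ} (p : RePairing w) (t : ℕ) : Finset ℕ :=
  ((p.pairs.take t).flatMap fun q => [q.1, q.2]).toFinset

namespace RePairing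

variable {w : List ℤ} (p : RePairing w)

theorem erased_mono {s t : ℕ} (h : s ≤ t) : p.erased s ⊆ p.erased t := by
  intro x hx
  simp only [erased, List.mem_toFinset, List.mem_flatMap] at hx ⊢
  obtain ⟨q, hq, hxq⟩ := hx
  exact ⟨q, (List.take_sublist_take_left h).subset hq, hxq⟩

theorem erased_zero : p.erased 0 = ∅ := by simp [erased]

theorem erased_length : p.erased p.pairs.length = Finset.range w.length := by
  ext x
  rw [erased, List.take_length, List.mem_toFinset, p.perm.mem_iff, List.mem_range,
    Finset.mem_range]

theorem erased_succ_subset (t : ℕ) : ∃ l r, p.erased (t + 1) ⊆ p.erased t ∪ {l, r} := by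
  rcases lt_or_ge t p.pairs.length with ht | ht
  · refine ⟨p.pairs[t].1, p.pairs[t].2, fun x hx => ?_⟩
    rw [erased, List.take_add_one, List.getElem?_eq_getElem ht, List.flatMap_append] at hx
    simpa [erased] using hx
  · refine ⟨0, 0, fun x hx => Finset.mem_union_left _ ?_⟩
    rw [erased, List.take_of_length_le (by omega)] at hx
    rwa [erased, List.take_of_length_le ht]

theorem setWidth_erased_le (t : ℕ) : setWidth (p.erased t) ≤ repWidth p := by
  have h := Finset.le_sup (f := fun t => setWidth (p.erased t))
    (show min t p.pairs.length ∈ Finset.range (p.pairs.length + 1) by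
      rw [Finset.mem_range]; omega)
  have heq : p.erased (min t p.pairs.length) = p.erased t := by
    rw [erased, erased, ← List.take_take, List.take_length]
  simp only [heq] at h
  exact h

theorem nodup_take (t : ℕ) : ((p.pairs.take t).flatMap fun q => [q.1, q.2]).Nodup :=
  (p.perm.nodup_iff.2 List.nodup_range).sublist
    ((List.take_sublist t _).flatMap _)

end RePairing

theorem erasedSum_erased {H : ℕ → ℤ} {L : ℕ} (p : RePairing (heightWord H L)) (t : ℕ) {x : ℕ}
    (hx : x ≤ L) :
    erasedSum H (p.erased t) x = ((p.pairs.take t).map fun q =>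
      (if q.1 < x then (1 : ℤ) else 0) - if q.2 < x then 1 else 0).sum := by
  have h1 : erasedSum H (p.erased t) x =
      ∑ y ∈ p.erased t, if y < x then (heightWord H L).getD y 0 else 0 := by
    rw [erasedSum, ← Finset.sum_filter, ← Finset.sum_filter]
    refine Finset.sum_congr ?_ fun y hy => ?_
    · ext y
      simp only [Finset.mem_filter, Finset.mem_range]
      tauto
    · rw [getD_heightWord H (lt_of_lt_of_le (Finset.mem_filter.1 hy).2 hx)]
  rw [h1, RePairing.erased, List.sum_toFinset _ (p.nodup_take t), List.map_flatMap,
    List.flatMap_def, List.sum_flatten, List.map_map]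
  congr 1
  refine List.map_congr_left fun q hq => ?_
  have hq := List.mem_of_mem_take hq
  simp only [Function.comp_apply, List.map_cons, List.map_nil, List.sum_cons, List.sum_nil, p.plus q hq, p.minus q hq]
  split_ifs <;> simp

theorem erasedSum_erased_mono {H : ℕ → ℤ} {L : ℕ} (p : RePairing (heightWord H L)) {s t x : ℕ}
    (hst : s ≤ t) (hx : x ≤ L) :
    erasedSum H (p.erased s) x ≤ erasedSum H (p.erased t) x := by
  rw [erasedSum_erased p s hx, erasedSum_erased p t hx]
  refine ((List.take_sublist_take_left hst).map _).sum_le_sum fun z hz => ?_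
  obtain ⟨q, hq, rfl⟩ := List.mem_map.1 hz
  have := p.lt q (List.mem_of_mem_take hq)
  split_ifs <;> omega

theorem erasedSum_erased_nonneg {H : ℕ → ℤ} {L : ℕ} (p : RePairing (heightWord H L)) (t : ℕ)
    {x : ℕ} (hx : x ≤ L) : 0 ≤ erasedSum H (p.erased t) x := by
  have := erasedSum_erased_mono p (Nat.zero_le t) hx
  rwa [p.erased_zero, erasedSum_of_forall_notMem (Nat.zero_le x) (by simp),
    erasedSum_zero] at this

theorem erasedSum_erased_le {H : ℕ → ℤ} {L : ℕ} (p : RePairing (heightWord H L)) (t : ℕ)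
    {x : ℕ} (hx : x ≤ L) : erasedSum H (p.erased t) x ≤ H x - H 0 := by
  have h := erasedSum_erased_mono p (le_max_left t p.pairs.length) hx
  have hr : ∀ y, 0 ≤ y → y < x → y ∈ p.erased (max t p.pairs.length) := fun y _ hy =>
    p.erased_mono (le_max_right _ _) (by
      rw [p.erased_length, Finset.mem_range, length_heightWord]; omega)
  rwa [erasedSum_of_forall_mem (Nat.zero_le x) hr, erasedSum_zero, zero_add] at h

theorem exists_boundaryCount_erased_pos {w : List ℤ} (p : RePairing w) {x : ℕ}
    (hx : x + 4 ≤ w.length) : ∃ t, 0 < boundaryCount (p.erased t) x (x + 4) := by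
  by_contra! hcon
  have huni : ∀ t y, x ≤ y → y < x + 4 → (x ∈ p.erased t ↔ y ∈ p.erased t) := fun t y h1 h2 =>
    mem_iff_of_boundaryCount_eq_zero (Nat.le_zero.1 (hcon t)) le_rfl h1 h2
  have hex : ∃ t, x ∈ p.erased t :=
    ⟨p.pairs.length, by rw [p.erased_length, Finset.mem_range]; omega⟩
  classical
  obtain ⟨t, ht⟩ : ∃ t, Nat.find hex = t + 1 := by
    refine ⟨Nat.find hex - 1, ?_⟩
    have : Nat.find hex ≠ 0 := fun h0 => by
      have := Nat.find_spec hex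
      rw [h0, p.erased_zero] at this
      simp at this
    omega
  have hmem := Nat.find_spec hex
  have hnot : x ∉ p.erased t := Nat.find_min hex (by omega)
  rw [ht] at hmem
  obtain ⟨l, r, hlr⟩ := p.erased_succ_subset t
  have key : ∀ y, x ≤ y → y < x + 4 → y = l ∨ y = r := fun y h1 h2 => by
    have := hlr ((huni (t + 1) y h1 h2).1 hmem)
    rw [Finset.mem_union, ← huni t y h1 h2] at this
    simpa [hnot] using this
  have h0 := key x (by omega) (by omega)
  have h1 := key (x + 1) (by omega) (by omega)
  have h2 := key (x + 2) (by omega) (by omega)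
  omega

theorem boundaryCount_le_two_mul_setWidth (E : Finset ℕ) (a b : ℕ) :
    boundaryCount E a b ≤ 2 * setWidth E := by
  have hne : {k | ∃ f : Fin k → ℕ × ℕ,
      (E : Set ℕ) = ⋃ i, Set.Icc (f i).1 (f i).2}.Nonempty := by
    refine ⟨E.card, fun i => ((E.equivFin.symm i : ℕ), (E.equivFin.symm i : ℕ)), ?_⟩
    ext x
    simp only [Finset.mem_coe, Set.Icc_self, Set.mem_iUnion, Set.mem_singleton_iff]
    exact ⟨fun hx => ⟨E.equivFin ⟨x, hx⟩, by simp⟩, by rintro ⟨i, rfl⟩; simp⟩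
  obtain ⟨f, hf⟩ := Nat.sInf_mem hne
  change (E : Set ℕ) = _ at hf
  have hmem : ∀ x, x ∈ E ↔ ∃ i, (f i).1 ≤ x ∧ x ≤ (f i).2 := fun x => by
    simpa only [Finset.mem_coe, Set.mem_iUnion, Set.mem_Icc] using Set.ext_iff.1 hf x
  have hsub : {p ∈ Finset.Ico a b | p + 1 < b ∧ ¬(p ∈ E ↔ p + 1 ∈ E)} ⊆
      Finset.univ.image (fun i => (f i).2) ∪ Finset.univ.image (fun i => (f i).1 - 1) := by
    intro p hp
    obtain ⟨-, -, hp⟩ := Finset.mem_filter.1 hp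
    simp only [Finset.mem_union, Finset.mem_image, Finset.mem_univ, true_and]
    by_cases h : p ∈ E
    · obtain ⟨i, hi⟩ := (hmem p).1 h
      have : ¬ ((f i).1 ≤ p + 1 ∧ p + 1 ≤ (f i).2) := fun h' => by
        have := (hmem (p + 1)).2 ⟨i, h'⟩
        tauto
      exact Or.inl ⟨i, by omega⟩
    · obtain ⟨i, hi⟩ := (hmem (p + 1)).1 (by tauto)
      have : ¬ ((f i).1 ≤ p ∧ p ≤ (f i).2) := fun h' => h ((hmem p).2 ⟨i, h'⟩)
      exact Or.inr ⟨i, by omega⟩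
  calc boundaryCount E a b ≤ _ := Finset.card_le_card hsub
    _ ≤ _ := Finset.card_union_le _ _
    _ ≤ setWidth E + setWidth E := by
      gcongr <;> exact Finset.card_image_le.trans (by rw [Finset.card_univ, Fintype.card_fin]; rfl)
    _ = 2 * setWidth E := by ring

theorem lt_two_mul_dyckWidth_ridge {K m l : ℕ} (hK : l + 3 ≤ K) (hm : (K + 1) ^ l + 2 < m) :
    l < 2 * dyckWidth (heightWord (ridgeHeight K m l) (ridgeLength K m l)) := by
  have hK0 : 0 < K := by omega
  have h0 := ridgeHeight_zero_right K m l
  obtain ⟨p₀⟩ := nonempty_rePairing_heightWord h0 (ridgeHeight_length K m l)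
    (fun n => (ridgeHeight_bounds hK0 m l n).1) (ridgeHeight_succ_sub hK0 m l)
  obtain ⟨p, hp⟩ := Nat.sInf_mem (s := {k | ∃ p : RePairing
    (heightWord (ridgeHeight K m l) (ridgeLength K m l)), repWidth p = k}) ⟨_, p₀, rfl⟩
  obtain ⟨t, ht⟩ := exists_lt_boundaryCount_ridge (E := p.erased) hK hm
    (fun s t hst => p.erased_mono hst) (fun s t y hst hy => erasedSum_erased_mono p hst hy)
    (fun t x hx => erasedSum_erased_nonneg p t hx)
    (fun t x hx => by simpa only [h0, sub_zero] using erasedSum_erased_le p t hx)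
    (fun x hx => exists_boundaryCount_erased_pos p (by rwa [length_heightWord]))
    le_rfl (x := 0) (by omega) (fun n _ => by rw [h0, zero_add, zero_add])
  calc l < _ := ht
    _ ≤ 2 * setWidth (p.erased t) := boundaryCount_le_two_mul_setWidth _ _ _
    _ ≤ 2 * repWidth p := by gcongr; exact p.setWidth_erased_le t
    _ = _ := by rw [hp]; rfl

/-- There is a sequence of Dyck words (Wₙ) of unbounded length and a constant
c > 0 with width(Wₙ) ≥ c·√(log |Wₙ| / log log |Wₙ|) for all large n. -/
theorem exists_dyck_words_width_lower : ∃ (W : ℕ → List ℤ) (c : ℝ), 0 < c ∧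
    (∀ n, IsDyck (W n)) ∧
    Filter.Tendsto (fun n => (W n).length) Filter.atTop Filter.atTop ∧
    ∀ᶠ n in Filter.atTop,
      c * Real.sqrt (Real.log ((W n).length : ℝ) /
          Real.log (Real.log ((W n).length : ℝ)))
        ≤ (dyckWidth (W n) : ℝ) := by
  have hm : ∀ n : ℕ, (n + 3 + 1) ^ n + 2 < (n + 4) ^ (n + 1) := fun n => by
    have : 1 ≤ (n + 4) ^ n := Nat.one_le_pow _ _ (by omega)
    have : (n + 4) ^ n * 4 ≤ (n + 4) ^ n * (n + 4) := Nat.mul_le_mul_left _ (by omega)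
    change (n + 4) ^ n + 2 < _
    rw [pow_succ]
    omega
  have hlow : ∀ n : ℕ, (n + 4) ^ ((n + 1) * n) ≤ ridgeLength (n + 3) ((n + 4) ^ (n + 1)) n :=
    fun n => by rw [pow_mul]; exact pow_le_ridgeLength _ _ _
  have hup : ∀ n : ℕ, ridgeLength (n + 3) ((n + 4) ^ (n + 1)) n ≤
      (n + 4) ^ ((n + 2) * (n + 1)) := fun n => by
    refine (ridgeLength_le le_rfl).trans ?_
    rw [pow_mul, pow_succ (n + 4) (n + 1), mul_comm _ (n + 4)]
    gcongr
    omega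
  refine ⟨fun n => heightWord (ridgeHeight (n + 3) ((n + 4) ^ (n + 1)) n)
    (ridgeLength (n + 3) ((n + 4) ^ (n + 1)) n), 1 / 4, by norm_num, fun n => ?_, ?_, ?_⟩
  · exact isDyck_heightWord (ridgeHeight_zero_right _ _ _) (ridgeHeight_length _ _ _)
      (fun k => (ridgeHeight_bounds (by omega) _ _ k).1) (ridgeHeight_succ_sub (by omega) _ _)
  · simp only [length_heightWord]
    refine Filter.tendsto_atTop_mono (fun n => ?_) Filter.tendsto_id
    calc n ≤ (n + 4) ^ n := (Nat.lt_pow_self (by omega)).le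
      _ ≤ (n + 4) ^ ((n + 1) * n) := Nat.pow_le_pow_right (by omega) (by nlinarith)
      _ ≤ _ := hlow n
  · filter_upwards [Filter.eventually_ge_atTop 2] with n hn
    have hwidth := lt_two_mul_dyckWidth_ridge (K := n + 3) (l := n) le_rfl (hm n)
    simp only [length_heightWord]
    have hlow := hlow n
    have hup := hup n
    generalize ridgeLength (n + 3) ((n + 4) ^ (n + 1)) n = L at *
    generalize dyckWidth _ = d at *
    have hn' : (2 : ℝ) ≤ n := by exact_mod_cast hn
    have hd : (n : ℝ) + 1 ≤ 2 * d := by exact_mod_cast hwidth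
    have hb : 1 ≤ Real.log (n + 4) := by
      rw [Real.le_log_iff_exp_le (by positivity)]
      linarith [Real.exp_one_lt_d9]
    have hL0 : (0 : ℝ) < L := by
      exact_mod_cast lt_of_lt_of_le (by positivity) hlow
    have hx1 : ((n + 1) * n : ℝ) * Real.log (n + 4) ≤ Real.log L := by
      have := Real.log_le_log (by positivity)
        (show ((n : ℝ) + 4) ^ ((n + 1) * n) ≤ L by exact_mod_cast hlow)
      rw [Real.log_pow] at this
      exact_mod_cast this
    have hx2 : Real.log L ≤ ((n + 2) * (n + 1) : ℝ) * Real.log (n + 4) := by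
      have := Real.log_le_log hL0
        (show (L : ℝ) ≤ ((n : ℝ) + 4) ^ ((n + 2) * (n + 1)) by exact_mod_cast hup)
      rw [Real.log_pow] at this
      exact_mod_cast this
    have hx3 : (n : ℝ) + 4 ≤ Real.log L := by nlinarith
    have hloglog : Real.log (n + 4) ≤ Real.log (Real.log L) :=
      Real.log_le_log (by positivity) hx3
    have hsqrt : Real.sqrt (Real.log L / Real.log (Real.log L)) ≤ n + 2 := by
      rw [Real.sqrt_le_left (by positivity), div_le_iff₀ (by linarith)]
      calc Real.log L ≤ ((n + 2) * (n + 1) : ℝ) * Real.log (n + 4) := hx2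
        _ ≤ (n + 2) ^ 2 * Real.log (Real.log L) := by
          gcongr
          nlinarith
    linarith
end
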